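/- arXiv:1606.00804 — 4 statements merged into one kernel-verified Lean document; each statement's English description precedes it below -/
import Mathlib

section
/- Let A be a finite alphabet with |A| ≥ 3. Then there exists a reversible gate class over A that is not finitely generated, i.e. a gate class S such that there is no finite set I of reversible gates with ⟨I⟩ = S. Concretely, writing A ⊇ {1,2,3} and T_n = τ_{1^n 2, 1^n 3} for n ≥ 1, the gate class T = ⟨T_n : n ≥ 1⟩ is not finitely generated. -/
/-- A reversible gate function of arity `n` over alphabet `A`: a bijection `A^n → A^n`. -/
abbrev GateFun (A : Type*) (n : ℕ) := (Fin n → A) ≃ (Fin n → A)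

/-- A reversible gate over alphabet `A`: an arity together with a bijection of that arity. -/
abbrev Gate (A : Type*) := Σ n : ℕ, GateFun A n

/-- The canonical identification `A^{n+m} ≃ A^n × A^m`. -/
def splitEquiv (A : Type*) (n m : ℕ) :
    (Fin (n + m) → A) ≃ ((Fin n → A) × (Fin m → A)) :=
  (Equiv.arrowCongr finSumFinEquiv.symm (Equiv.refl A)).trans
    (Equiv.sumArrowEquivProdArrow _ _ A)

/-- The permutation gate `P_σ`, mapping `(a_1,…,a_n)` to `(a_{σ(1)},…,a_{σ(n)})`. -/
def permGate (A : Type*) {n : ℕ} (σ : Equiv.Perm (Fin n)) : GateFun A n :=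
  Equiv.arrowCongr σ.symm (Equiv.refl A)

/-- Tensor product of gates. -/
def tensorGate {A : Type*} {n m : ℕ} (F : GateFun A n) (G : GateFun A m) :
    GateFun A (n + m) :=
  ((splitEquiv A n m).trans (F.prodCongr G)).trans (splitEquiv A n m).symm

/-- The generation relation: `Generates S g` means `g` can be generated from the set `S`
of reversible gates using the permutation, tensor product, composition and ancilla rules. -/
inductive Generates {A : Type*} (S : Set (Gate A)) : Gate A → Prop
  | mem {g : Gate A} : g ∈ S → Generates S g
  | perm (n : ℕ) (σ : Equiv.Perm (Fin n)) : Generates S ⟨n, permGate A σ⟩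
  | tensor {n m : ℕ} {F : GateFun A n} {G : GateFun A m} :
      Generates S ⟨n, F⟩ → Generates S ⟨m, G⟩ → Generates S ⟨n + m, tensorGate F G⟩
  | comp {n : ℕ} {F G : GateFun A n} :
      Generates S ⟨n, F⟩ → Generates S ⟨n, G⟩ → Generates S ⟨n, G.trans F⟩
  | ancilla {l m : ℕ} {F : GateFun A (l + m)} (a : Fin l → A) {F' : GateFun A m} :
      Generates S ⟨l + m, F⟩ →
      (∀ b : Fin m → A,
        F ((splitEquiv A l m).symm (a, b)) = (splitEquiv A l m).symm (a, F' b)) →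
      Generates S ⟨m, F'⟩

/-- The gate class `⟨S⟩` generated by a set `S` of reversible gates. -/
def genClosure {A : Type*} (S : Set (Gate A)) : Set (Gate A) := {g | Generates S g}

/-- A reversible gate class: a set of gates closed under the generation rules. -/
def IsGateClass {A : Type*} (S : Set (Gate A)) : Prop := ∀ g, Generates S g → g ∈ S

/-- The transposition gate `τ_{u,v}` exchanging the inputs `u` and `v`. -/
def tau {A : Type*} [DecidableEq A] {n : ℕ} (u v : Fin n → A) : GateFun A n :=
  Equiv.swap u v

/-- The controlled gate `w-F`, mapping `w u` to `w F(u)` and fixing all other inputs. -/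
def controlled {A : Type*} [DecidableEq A] {l n : ℕ} (w : Fin l → A) (F : GateFun A n) :
    GateFun A (l + n) :=
  ((splitEquiv A l n).trans
    (Equiv.prodCongrRight fun p => if p = w then F else Equiv.refl _)).trans
    (splitEquiv A l n).symm

/-- `SWAP_{a,b}` for single symbols `a`, `b`: exchanges `ab` and `ba`. -/
def swapGate {A : Type*} [DecidableEq A] (a b : A) : GateFun A 2 :=
  tau ![a, b] ![b, a]

/-- Number of occurrences of the symbol `a` in the string `x`. -/
def countOf {A : Type*} [DecidableEq A] {n : ℕ} (a : A) (x : Fin n → A) : ℕ :=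
  (Finset.univ.filter fun i => x i = a).card

/-- The string `x^n y`: `n` copies of `x` followed by one `y`. -/
def strT {A : Type*} (x y : A) (n : ℕ) : Fin (n + 1) → A :=
  fun i => if (i : ℕ) < n then x else y

section NonFinitelyGenerated

variable {A : Type*}

/-- Applies the transposition `(b c)` to a symbol if the control value is nonzero. -/
def condSwap [DecidableEq A] (b c : A) (z : ZMod 2) : Equiv.Perm A :=
  if z = 0 then 1 else Equiv.swap b c

/-- The functions `g : A^ι → 𝔽₂` depending only on which of at most `N` coordinates equal `e`. -/
def juntas (e : A) (N : ℕ) (ι : Type*) : Set ((ι → A) → ZMod 2) :=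
  {g | ∃ S : Finset ι, S.card ≤ N ∧
    ∀ x y : ι → A, (∀ i ∈ S, (x i = e ↔ y i = e)) → g x = g y}

/-- Functions of degree at most `N` in the indicators of the symbol `e`: sums of `N`-juntas. -/
def lowDegree (e : A) (N : ℕ) (ι : Type*) : Submodule (ZMod 2) ((ι → A) → ZMod 2) :=
  Submodule.span (ZMod 2) (juntas e N ι)

/-- A gate that rewires its inputs and exchanges the symbols `b`, `c` on each wire under the
control of a function of degree at most `N` in the indicators of `e`. -/
def HasDegreeLE [DecidableEq A] (e b c : A) (N : ℕ) (g : Gate A) : Prop :=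
  ∃ (σ : Fin g.1 → Fin g.1) (f : Fin g.1 → (Fin g.1 → A) → ZMod 2),
    (∀ i, f i ∈ lowDegree e N (Fin g.1)) ∧
      ∀ x i, g.2 x i = condSwap b c (f i x) (x (σ i))

theorem zmod_two_eq_zero_or_one (z : ZMod 2) : z = 0 ∨ z = 1 := by
  revert z
  decide

theorem condSwap_add [DecidableEq A] (b c : A) (z w : ZMod 2) (a : A) :
    condSwap b c (z + w) a = condSwap b c z (condSwap b c w a) := by
  have h : (1 : ZMod 2) + 1 = 0 := by decide
  rcases zmod_two_eq_zero_or_one z with rfl | rfl <;>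
      rcases zmod_two_eq_zero_or_one w with rfl | rfl <;> simp [condSwap, h]

theorem condSwap_eq_iff [DecidableEq A] {e b c : A} (hb : e ≠ b) (hc : e ≠ c) (z : ZMod 2)
    (a : A) : condSwap b c z a = e ↔ a = e := by
  rw [← Equiv.eq_symm_apply]
  unfold condSwap
  split_ifs
  · rfl
  · rw [Equiv.symm_swap, Equiv.swap_apply_of_ne_of_ne hb hc]

theorem lowDegree_mono (e : A) {N M : ℕ} (h : N ≤ M) (ι : Type*) :
    lowDegree e N ι ≤ lowDegree e M ι :=
  Submodule.span_mono fun _ ⟨S, hS, hg⟩ => ⟨S, hS.trans h, hg⟩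

theorem lowDegree_comp {e : A} {N : ℕ} {ι κ : Type*} {φ : (κ → A) → (ι → A)}
    (hφ : ∀ j, ∃ s : Finset κ, s.card ≤ 1 ∧
      ∀ x y : κ → A, (∀ i ∈ s, (x i = e ↔ y i = e)) → (φ x j = e ↔ φ y j = e))
    {g : (ι → A) → ZMod 2} (hg : g ∈ lowDegree e N ι) :
    (fun x => g (φ x)) ∈ lowDegree e N κ := by
  classical
  choose s hs hsφ using hφ
  refine (Submodule.span_le (p := (lowDegree e N κ).comap
    (LinearMap.funLeft (ZMod 2) (ZMod 2) φ))).2 ?_ hg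
  rintro g ⟨S, hS, hg⟩
  refine Submodule.subset_span ⟨S.biUnion s, ?_, fun x y h => hg _ _ fun j hj => ?_⟩
  · calc (S.biUnion s).card ≤ S.card * 1 := Finset.card_biUnion_le_card_mul _ _ _ fun j _ => hs j
      _ ≤ N := by omega
  · exact hsφ j x y fun i hi => h i (Finset.mem_biUnion.2 ⟨j, hj, hi⟩)

theorem lowDegree_comp_wires {e : A} {N : ℕ} {ι κ : Type*} {φ : (κ → A) → (ι → A)} (k : ι → κ)
    (hφ : ∀ x j, φ x j = e ↔ x (k j) = e)
    {g : (ι → A) → ZMod 2} (hg : g ∈ lowDegree e N ι) :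
    (fun x => g (φ x)) ∈ lowDegree e N κ :=
  lowDegree_comp (fun j => ⟨{k j}, by simp, fun x y h => by
    rw [hφ, hφ]; exact h _ (Finset.mem_singleton_self _)⟩) hg

theorem splitEquiv_symm_castAdd {n m : ℕ} (a : Fin n → A) (b : Fin m → A) (i : Fin n) :
    (splitEquiv A n m).symm (a, b) (Fin.castAdd m i) = a i :=
  congrFun (congrArg Prod.fst ((splitEquiv A n m).apply_symm_apply (a, b))) i

theorem splitEquiv_symm_natAdd {n m : ℕ} (a : Fin n → A) (b : Fin m → A) (j : Fin m) :
    (splitEquiv A n m).symm (a, b) (Fin.natAdd n j) = b j :=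
  congrFun (congrArg Prod.snd ((splitEquiv A n m).apply_symm_apply (a, b))) j

section Invariance

variable [DecidableEq A] {e b c : A} {N : ℕ}

theorem HasDegreeLE.mono {M : ℕ} (h : N ≤ M) {g : Gate A} (hg : HasDegreeLE e b c N g) :
    HasDegreeLE e b c M g := by
  obtain ⟨σ, f, hf, hF⟩ := hg
  exact ⟨σ, f, fun i => lowDegree_mono e h _ (hf i), hF⟩

theorem hasDegreeLE_permGate (n : ℕ) (σ : Equiv.Perm (Fin n)) :
    HasDegreeLE e b c N ⟨n, permGate A σ⟩ :=
  ⟨σ, 0, fun _ => Submodule.zero_mem _, fun x i => by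
    simp [condSwap, permGate, Equiv.arrowCongr]⟩

theorem HasDegreeLE.tensor {n m : ℕ} {F : GateFun A n} {G : GateFun A m}
    (hF : HasDegreeLE e b c N ⟨n, F⟩) (hG : HasDegreeLE e b c N ⟨m, G⟩) :
    HasDegreeLE e b c N ⟨n + m, tensorGate F G⟩ := by
  obtain ⟨σ, f, hf, hF⟩ := hF
  obtain ⟨τ, g, hg, hG⟩ := hG
  dsimp only at σ f hf hF τ g hg hG
  refine ⟨Fin.addCases (fun i => Fin.castAdd m (σ i)) (fun j => Fin.natAdd n (τ j)),
    Fin.addCases (fun i x => f i fun k => x (Fin.castAdd m k))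
      (fun j x => g j fun k => x (Fin.natAdd n k)), fun i => ?_, fun x i => ?_⟩
  · refine Fin.addCases (fun i => ?_) (fun j => ?_) i
    · simpa only [Fin.addCases_left] using
        lowDegree_comp_wires (Fin.castAdd m) (fun _ _ => Iff.rfl) (hf i)
    · simpa only [Fin.addCases_right] using
        lowDegree_comp_wires (Fin.natAdd n) (fun _ _ => Iff.rfl) (hg j)
  · have hx : tensorGate F G x = (splitEquiv A n m).symm
        (F fun k => x (Fin.castAdd m k), G fun k => x (Fin.natAdd n k)) := rfl
    change tensorGate F G x i = _
    rw [hx]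
    refine Fin.addCases (fun i => ?_) (fun j => ?_) i
    · simp only [Fin.addCases_left, splitEquiv_symm_castAdd, hF]
    · simp only [Fin.addCases_right, splitEquiv_symm_natAdd, hG]

theorem HasDegreeLE.comp (hb : e ≠ b) (hc : e ≠ c) {n : ℕ} {F G : GateFun A n}
    (hF : HasDegreeLE e b c N ⟨n, F⟩) (hG : HasDegreeLE e b c N ⟨n, G⟩) :
    HasDegreeLE e b c N ⟨n, G.trans F⟩ := by
  obtain ⟨σ, f, hf, hF⟩ := hF
  obtain ⟨τ, g, hg, hG⟩ := hG
  dsimp only at σ f hf hF τ g hg hG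
  refine ⟨fun i => τ (σ i), fun i => (fun x => f i (G x)) + g (σ i), fun i => ?_, fun x i => ?_⟩
  · refine Submodule.add_mem _ (lowDegree_comp_wires τ (fun x j => ?_) (hf i)) (hg _)
    rw [hG, condSwap_eq_iff hb hc]
  · change F (G x) i = condSwap b c (f i (G x) + g (σ i) x) (x (τ (σ i)))
    rw [condSwap_add, ← hG, hF]

theorem HasDegreeLE.ancilla (hb : e ≠ b) (hc : e ≠ c) {l m : ℕ} {F : GateFun A (l + m)}
    (a : Fin l → A) {F' : GateFun A m} (hF : HasDegreeLE e b c N ⟨l + m, F⟩)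
    (h : ∀ x : Fin m → A,
      F ((splitEquiv A l m).symm (a, x)) = (splitEquiv A l m).symm (a, F' x)) :
    HasDegreeLE e b c N ⟨m, F'⟩ := by
  obtain ⟨σ, f, hf, hF⟩ := hF
  dsimp only at σ f hf hF
  have key : ∀ x j, F' x j = condSwap b c (f (Fin.natAdd l j) ((splitEquiv A l m).symm (a, x)))
      ((splitEquiv A l m).symm (a, x) (σ (Fin.natAdd l j))) := fun x j => by
    rw [← hF, h, splitEquiv_symm_natAdd]
  have hσ : ∀ j, ∃ k, σ (Fin.natAdd l j) = Fin.natAdd l k := by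
    intro j
    induction hi : σ (Fin.natAdd l j) using Fin.addCases with
    | right k => exact ⟨k, rfl⟩
    | left i =>
      have hconst : ∀ y : Fin m → A, y j = e ↔ a i = e := fun y => by
        rw [← F'.apply_symm_apply y, key, hi, splitEquiv_symm_castAdd, condSwap_eq_iff hb hc]
      exact absurd ((hconst fun _ => b).2 ((hconst fun _ => e).1 rfl)).symm hb
  choose σ' hσ' using hσ
  refine ⟨σ', fun j x => f (Fin.natAdd l j) ((splitEquiv A l m).symm (a, x)), fun j => ?_,
    fun x j => ?_⟩
  · refine lowDegree_comp (fun i => ?_) (hf _)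
    induction i using Fin.addCases with
    | left i => exact ⟨∅, by simp, fun x y _ => by simp only [splitEquiv_symm_castAdd]⟩
    | right k =>
      exact ⟨{k}, by simp, fun x y h => by
        simpa only [splitEquiv_symm_natAdd] using h k (Finset.mem_singleton_self k)⟩
  · change F' x j = _
    rw [key, hσ', splitEquiv_symm_natAdd]

theorem Generates.hasDegreeLE (hb : e ≠ b) (hc : e ≠ c) {S : Set (Gate A)}
    (hS : ∀ g ∈ S, HasDegreeLE e b c N g) {g : Gate A} (hg : Generates S g) :
    HasDegreeLE e b c N g := by
  induction hg with
  | mem h => exact hS _ h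
  | perm n σ => exact hasDegreeLE_permGate n σ
  | tensor _ _ hF hG => exact hF.tensor hG
  | comp _ _ hF hG => exact hF.comp hb hc hG
  | ancilla a _ h hF => exact hF.ancilla hb hc a h

theorem Generates.exists_hasDegreeLE (hb : e ≠ b) (hc : e ≠ c) {S : Set (Gate A)}
    (hS : ∀ g ∈ S, ∃ N, HasDegreeLE e b c N g) {g : Gate A} (hg : Generates S g) :
    ∃ N, HasDegreeLE e b c N g := by
  induction hg with
  | mem h => exact hS _ h
  | perm n σ => exact ⟨0, hasDegreeLE_permGate n σ⟩
  | tensor _ _ hF hG =>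
    obtain ⟨N, hF⟩ := hF
    obtain ⟨M, hG⟩ := hG
    exact ⟨max N M, (hF.mono (le_max_left _ _)).tensor (hG.mono (le_max_right _ _))⟩
  | comp _ _ hF hG =>
    obtain ⟨N, hF⟩ := hF
    obtain ⟨M, hG⟩ := hG
    exact ⟨max N M, (hF.mono (le_max_left _ _)).comp hb hc (hG.mono (le_max_right _ _))⟩
  | ancilla a _ h hF =>
    obtain ⟨N, hF⟩ := hF
    exact ⟨N, hF.ancilla hb hc a h⟩

end Invariance

theorem strT_castSucc (x y : A) (n : ℕ) (i : Fin n) : strT x y n i.castSucc = x := by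
  simp [strT]

theorem strT_last (x y : A) (n : ℕ) : strT x y n (Fin.last n) = y := by
  simp [strT]

theorem eq_strT {x y : A} {n : ℕ} {u : Fin (n + 1) → A} (h : ∀ i : Fin n, u i.castSucc = x)
    (hy : u (Fin.last n) = y) : u = strT x y n := by
  funext i
  induction i using Fin.lastCases with
  | last => rw [hy, strT_last]
  | cast i => rw [h, strT_castSucc]

theorem tau_strT_castSucc [DecidableEq A] (e b c : A) (n : ℕ) (x : Fin (n + 1) → A) (i : Fin n) :
    tau (strT e b n) (strT e c n) x i.castSucc = x i.castSucc := by
  unfold tau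
  rw [Equiv.swap_apply_def]
  split_ifs with h₁ h₂
  · rw [h₁, strT_castSucc, strT_castSucc]
  · rw [h₂, strT_castSucc, strT_castSucc]
  · rfl

theorem tau_strT_last [DecidableEq A] (e b c : A) (n : ℕ) (x : Fin (n + 1) → A) :
    tau (strT e b n) (strT e c n) x (Fin.last n) =
      condSwap b c (if ∀ i : Fin n, x i.castSucc = e then 1 else 0) (x (Fin.last n)) := by
  by_cases h : ∀ i : Fin n, x i.castSucc = e
  · rw [if_pos h]
    simp only [condSwap, one_ne_zero, if_false]
    generalize hy : x (Fin.last n) = y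
    rw [eq_strT h hy]
    unfold tau
    rw [Equiv.swap_apply_def, Equiv.swap_apply_def]
    have inj : ∀ z w : A, strT e z n = strT e w n ↔ z = w := fun z w =>
      ⟨fun h => by rw [← strT_last e z n, h, strT_last], fun h => by rw [h]⟩
    simp only [inj]
    split_ifs <;> rw [strT_last]
  · rw [if_neg h]
    have hne : ∀ z, x ≠ strT e z n := fun z hx => h fun i => by rw [hx, strT_castSucc]
    simp [condSwap, tau, Equiv.swap_apply_of_ne_of_ne (hne b) (hne c)]

theorem hasDegreeLE_tau_strT [DecidableEq A] (e b c : A) (n : ℕ) :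
    HasDegreeLE e b c n ⟨n + 1, tau (strT e b n) (strT e c n)⟩ := by
  refine ⟨id, Fin.lastCases (fun x => if ∀ i : Fin n, x i.castSucc = e then 1 else 0) fun _ => 0,
    fun i => ?_, fun x i => ?_⟩
  · induction i using Fin.lastCases with
    | cast i => simp only [Fin.lastCases_castSucc, Submodule.zero_mem]
    | last =>
      simp only [Fin.lastCases_last]
      refine Submodule.subset_span ⟨Finset.univ.map Fin.castSuccEmb, by simp, fun x y h => ?_⟩
      have : (∀ i : Fin n, x i.castSucc = e) ↔ ∀ i : Fin n, y i.castSucc = e :=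
        forall_congr' fun i => h _ (by simp)
      simp only [this]
  · induction i using Fin.lastCases with
    | cast i => simpa [condSwap] using tau_strT_castSucc e b c n x i
    | last => simpa using tau_strT_last e b c n x

/-- A function of degree less than `n` sums to zero over a cube of dimension `n`. -/
theorem sum_cube_eq_zero_of_mem_lowDegree {e : A} {N n : ℕ} (hN : N < n) (b : A)
    {g : (Fin (n + 1) → A) → ZMod 2} (hg : g ∈ lowDegree e N (Fin (n + 1))) :
    ∑ t : Fin n → Bool,
      g (Fin.snoc (α := fun _ => A) (fun i => if t i then e else b) b) = 0 := by
  induction hg using Submodule.span_induction with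
  | zero => simp
  | add x y _ _ hx hy => simp only [Pi.add_apply, Finset.sum_add_distrib, hx, hy, add_zero]
  | smul r x _ hx => simp only [Pi.smul_apply, ← Finset.smul_sum, hx, smul_zero]
  | mem g hg =>
    obtain ⟨S, hS, hg⟩ := hg
    obtain ⟨k, hk⟩ : ∃ k : Fin n, k.castSucc ∉ S := by
      by_contra! hall
      have := Finset.card_le_card (s := Finset.univ.map Fin.castSuccEmb) (t := S) fun i hi => by
        obtain ⟨k, -, rfl⟩ := Finset.mem_map.1 hi
        exact hall k
      simp only [Finset.card_map, Finset.card_univ, Fintype.card_fin] at this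
      omega
    refine Finset.sum_involution (fun t _ => Function.update t k (!t k)) (fun t _ => ?_)
      (fun t _ _ h => ?_) (fun _ _ => Finset.mem_univ _) (fun t _ => by simp)
    · refine (congrArg (_ + ·) (hg _ _ fun i hi => ?_)).trans (CharTwo.add_self_eq_zero _)
      induction i using Fin.lastCases with
      | last => simp
      | cast i =>
        have : i ≠ k := by rintro rfl; exact hk hi
        simp [this]
    · simpa using congrFun h k

theorem not_hasDegreeLE_tau_strT [DecidableEq A] {e b c : A} (hb : e ≠ b) (hc : e ≠ c)
    (hbc : b ≠ c) {N n : ℕ} (hN : N < n) :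
    ¬ HasDegreeLE e b c N ⟨n + 1, tau (strT e b n) (strT e c n)⟩ := by
  rintro ⟨σ, f, hf, hF⟩
  dsimp only at σ f hf hF
  have hlast : ∀ x, condSwap b c (if ∀ i : Fin n, x i.castSucc = e then 1 else 0)
      (x (Fin.last n)) = condSwap b c (f (Fin.last n) x) (x (σ (Fin.last n))) := fun x => by
    rw [← tau_strT_last, hF]
  have hσ : σ (Fin.last n) = Fin.last n := by
    by_contra hne
    have h := condSwap_eq_iff hb hc (f (Fin.last n) (Function.update (fun _ => b) (Fin.last n) e))
      (Function.update (fun _ => b) (Fin.last n) e (σ (Fin.last n)))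
    rw [← hlast, condSwap_eq_iff hb hc, Function.update_self, Function.update_of_ne hne] at h
    exact hb (h.1 rfl).symm
  have hinj : ∀ z w : ZMod 2, condSwap b c z b = condSwap b c w b → z = w := by
    intro z w h
    rcases zmod_two_eq_zero_or_one z with rfl | rfl <;>
      rcases zmod_two_eq_zero_or_one w with rfl | rfl <;> simp_all [condSwap]
  have hsum := sum_cube_eq_zero_of_mem_lowDegree hN b (hf (Fin.last n))
  have hval : ∀ t : Fin n → Bool,
      f (Fin.last n) (Fin.snoc (α := fun _ => A) (fun i => if t i then e else b) b) =
        if t = fun _ => true then 1 else 0 := by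
    intro t
    have h := hlast (Fin.snoc (α := fun _ => A) (fun i => if t i then e else b) b)
    rw [hσ, Fin.snoc_last] at h
    rw [← hinj _ _ h]
    refine if_congr ?_ rfl rfl
    simp [funext_iff, hb.symm]
  simp [hval] at hsum

theorem isGateClass_genClosure (S : Set (Gate A)) : IsGateClass (genClosure S) := by
  intro g hg
  induction hg with
  | mem h => exact h
  | perm n σ => exact .perm n σ
  | tensor _ _ hF hG => exact .tensor hF hG
  | comp _ _ hF hG => exact .comp hF hG
  | ancilla a _ h hF => exact .ancilla a hF h

end NonFinitelyGenerated

/-- Over any alphabet of size at least 3 (with three distinguished distinct symbols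
`e₁,e₂,e₃` playing the roles of `1,2,3`), the gate class
`T = ⟨τ_{1^n 2, 1^n 3} : n ≥ 1⟩` is a reversible gate class that is not finitely
generated. -/
theorem exists_non_finitely_generated_class (A : Type*) [Fintype A] [DecidableEq A]
    (hA : 3 ≤ Fintype.card A) (e₁ e₂ e₃ : A)
    (h12 : e₁ ≠ e₂) (h13 : e₁ ≠ e₃) (h23 : e₂ ≠ e₃) :
    IsGateClass (genClosure {g : Gate A |
        ∃ n : ℕ, 1 ≤ n ∧ g = ⟨n + 1, tau (strT e₁ e₂ n) (strT e₁ e₃ n)⟩}) ∧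
      ¬ ∃ I : Set (Gate A), I.Finite ∧
          genClosure I = genClosure {g : Gate A |
            ∃ n : ℕ, 1 ≤ n ∧ g = ⟨n + 1, tau (strT e₁ e₂ n) (strT e₁ e₃ n)⟩} := by
  refine ⟨isGateClass_genClosure _, ?_⟩
  rintro ⟨I, hI, hgen⟩
  have hdeg : ∀ g ∈ I, ∃ N, HasDegreeLE e₁ e₂ e₃ N g := fun g hg => by
    have hmem : g ∈ genClosure I := .mem hg
    rw [hgen] at hmem
    refine Generates.exists_hasDegreeLE h12 h13 ?_ hmem
    rintro _ ⟨n, -, rfl⟩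
    exact ⟨n, hasDegreeLE_tau_strT e₁ e₂ e₃ n⟩
  choose! d hd using hdeg
  obtain ⟨N, hN⟩ := (hI.image d).bddAbove
  have hI' : ∀ g ∈ I, HasDegreeLE e₁ e₂ e₃ N g := fun g hg =>
    (hd g hg).mono (hN (Set.mem_image_of_mem d hg))
  have hmem : (⟨N + 1 + 1, tau (strT e₁ e₂ (N + 1)) (strT e₁ e₃ (N + 1))⟩ : Gate A) ∈
      genClosure I := by
    rw [hgen]
    exact .mem ⟨N + 1, by omega, rfl⟩
  exact not_hasDegreeLE_tau_strT h12 h13 h23 N.lt_succ_self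
    (Generates.hasDegreeLE h12 h13 hI' hmem)
end

section
/- Let A = {1,…,k} with k ≥ 3, and let S be the set of gates consisting of τ_{a,b} for all a ≠ b ∈ A together with τ_{11,12}. Then ⟨S⟩ = ALL, the class of all reversible gates over A. -/
namespace ReversibleGate

open Equiv

variable {A : Type*}

section Split

theorem splitEquiv_symm_castAdd {n m : ℕ} (a : Fin n → A) (b : Fin m → A) (i : Fin n) :
    (splitEquiv A n m).symm (a, b) (Fin.castAdd m i) = a i := by
  simp [splitEquiv, Equiv.sumArrowEquivProdArrow, Equiv.arrowCongr]

theorem splitEquiv_symm_natAdd {n m : ℕ} (a : Fin n → A) (b : Fin m → A) (i : Fin m) :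
    (splitEquiv A n m).symm (a, b) (Fin.natAdd n i) = b i := by
  simp [splitEquiv, Equiv.sumArrowEquivProdArrow, Equiv.arrowCongr]

theorem tensorGate_one_castAdd {n m : ℕ} (F : GateFun A n) (x : Fin (n + m) → A) (i : Fin n) :
    tensorGate F (1 : Perm (Fin m → A)) x (Fin.castAdd m i) =
      F (fun j => x (Fin.castAdd m j)) i := by
  simp only [tensorGate, Equiv.trans_apply, Equiv.prodCongr_apply, Prod.map]
  rw [splitEquiv_symm_castAdd]
  rfl

theorem tensorGate_one_natAdd {n m : ℕ} (F : GateFun A n) (x : Fin (n + m) → A) (i : Fin m) :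
    tensorGate F (1 : Perm (Fin m → A)) x (Fin.natAdd n i) = x (Fin.natAdd n i) := by
  simp only [tensorGate, Equiv.trans_apply, Equiv.prodCongr_apply, Prod.map]
  rw [splitEquiv_symm_natAdd]
  rfl

end Split

/-- The gates of arity `n` generated by `S`, as a subgroup of the permutations of `A^n`. -/
def genSubgroup [Finite A] (S : Set (Gate A)) (n : ℕ) : Subgroup (Perm (Fin n → A)) where
  carrier := {F | Generates S ⟨n, F⟩}
  mul_mem' hF hG := Generates.comp hF hG
  one_mem' := Generates.perm n 1
  inv_mem' := by
    intro F hF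
    have hpow : ∀ m : ℕ, Generates S ⟨n, F ^ m⟩ := by
      intro m
      induction m with
      | zero => exact Generates.perm n 1
      | succ m ih => rw [pow_succ]; exact Generates.comp ih hF
    have hinv : F⁻¹ = F ^ (orderOf F - 1) := by
      rw [inv_eq_iff_mul_eq_one, ← pow_succ', Nat.sub_add_cancel (orderOf_pos F), pow_orderOf_eq_one]
    show Generates S ⟨n, F⁻¹⟩
    rw [hinv]
    exact hpow _

section Ctl

variable [DecidableEq A] {ι : Type*} [DecidableEq ι]

/-- Apply `f` at position `i` provided that the input agrees with `w` on `s \ {i}`. -/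
def ctl (s : Finset ι) (w : ι → A) (i : ι) (f : Perm A) : Perm (ι → A) where
  toFun x := if ∀ j ∈ s, j ≠ i → x j = w j then Function.update x i (f (x i)) else x
  invFun x := if ∀ j ∈ s, j ≠ i → x j = w j then Function.update x i (f.symm (x i)) else x
  left_inv x := by
    by_cases h : ∀ j ∈ s, j ≠ i → x j = w j
    · have h' : ∀ j ∈ s, j ≠ i → Function.update x i (f (x i)) j = w j := fun j hj hji => by
        rw [Function.update_of_ne hji]; exact h j hj hji
      simp only [if_pos h, if_pos h']
      simp
    · simp only [if_neg h]
  right_inv x := by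
    by_cases h : ∀ j ∈ s, j ≠ i → x j = w j
    · have h' : ∀ j ∈ s, j ≠ i → Function.update x i (f.symm (x i)) j = w j := fun j hj hji => by
        rw [Function.update_of_ne hji]; exact h j hj hji
      simp only [if_pos h, if_pos h']
      simp
    · simp only [if_neg h]

theorem ctl_apply_of_ne (s : Finset ι) (w : ι → A) (i : ι) (f : Perm A) (x : ι → A) {j : ι}
    (h : j ≠ i) : ctl s w i f x j = x j := by
  simp only [ctl, Equiv.coe_fn_mk]
  split_ifs <;> simp [h]

theorem ctl_apply_of_pos {s : Finset ι} {w : ι → A} {i : ι} (f : Perm A) {x : ι → A}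
    (h : ∀ j ∈ s, j ≠ i → x j = w j) : ctl s w i f x = Function.update x i (f (x i)) :=
  if_pos h

theorem ctl_apply_of_neg {s : Finset ι} {w : ι → A} {i : ι} (f : Perm A) {x : ι → A}
    (h : ¬ ∀ j ∈ s, j ≠ i → x j = w j) : ctl s w i f x = x :=
  if_neg h

theorem ctl_mul (s : Finset ι) (w : ι → A) (i : ι) (f g : Perm A) :
    ctl s w i (f * g) = ctl s w i f * ctl s w i g := by
  ext1 x
  rw [Perm.mul_apply]
  by_cases h : ∀ j ∈ s, j ≠ i → x j = w j
  · have h' : ∀ j ∈ s, j ≠ i → Function.update x i (g (x i)) j = w j := fun j hj hji => by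
      rw [Function.update_of_ne hji]; exact h j hj hji
    rw [ctl_apply_of_pos _ h, ctl_apply_of_pos _ h, ctl_apply_of_pos _ h']
    simp
  · rw [ctl_apply_of_neg _ h, ctl_apply_of_neg _ h, ctl_apply_of_neg _ h]

/-- `ctl s w i` as a group homomorphism. -/
def ctlHom (s : Finset ι) (w : ι → A) (i : ι) : Perm A →* Perm (ι → A) :=
  MonoidHom.mk' (ctl s w i) (ctl_mul s w i)

theorem ctl_inv (s : Finset ι) (w : ι → A) (i : ι) (f : Perm A) :
    (ctl s w i f)⁻¹ = ctl s w i f⁻¹ :=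
  ((ctlHom s w i).map_inv f).symm

theorem ctl_congr {s : Finset ι} {w w' : ι → A} {i : ι} (f : Perm A)
    (h : ∀ j ∈ s, j ≠ i → w j = w' j) : ctl s w i f = ctl s w' i f := by
  have key : ∀ x : ι → A, (∀ j ∈ s, j ≠ i → x j = w j) ↔ ∀ j ∈ s, j ≠ i → x j = w' j :=
    fun x => forall_congr' fun j => forall_congr' fun hj => forall_congr' fun hji => by
      rw [h j hj hji]
  ext1 x
  simp only [ctl, Equiv.coe_fn_mk, key]

theorem ctl_empty_apply (w : ι → A) (i : ι) (f : Perm A) (x : ι → A) :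
    ctl ∅ w i f x = Function.update x i (f (x i)) :=
  ctl_apply_of_pos f (by simp)

/-- Conjugation by a permutation of the alphabet at the controlling position. -/
theorem ctl_conj_control (w v : ι → A) {i j : ι} (hij : j ≠ i) (f g : Perm A) :
    ctl ∅ v j g * ctl {j} w i f * (ctl ∅ v j g)⁻¹ =
      ctl {j} (Function.update w j (g (w j))) i f := by
  rw [mul_inv_eq_iff_eq_mul]
  ext1 x
  rw [Perm.mul_apply, Perm.mul_apply, ctl_empty_apply v j g x]
  by_cases h : x j = w j
  · rw [ctl_apply_of_pos (s := {j}) (w := w) f (by simpa using fun _ => h), ctl_empty_apply,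
      ctl_apply_of_pos _ (by simp [h])]
    simp only [Function.update_of_ne hij, Function.update_of_ne hij.symm]
    rw [Function.update_comm hij]
  · rw [ctl_apply_of_neg (s := {j}) (w := w) f (by simpa using ⟨hij, h⟩), ctl_empty_apply,
      ctl_apply_of_neg _ (by simpa [h] using hij)]

/-- The commutator of two gates with the same target is controlled by both controls. -/
theorem ctl_commutator (w : ι → A) {i j l : ι} (hji : j ≠ i) (hli : l ≠ i) (f g : Perm A) :
    ctl {j, l} w i (f * g * f⁻¹ * g⁻¹) =
      ctl {j} w i f * ctl {l} w i g * (ctl {j} w i f)⁻¹ * (ctl {l} w i g)⁻¹ := by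
  rw [ctl_inv, ctl_inv]
  ext1 x
  simp only [Perm.mul_apply]
  have e1 : ∀ (f : Perm A) (x : ι → A), ctl {j} w i f x =
      if x j = w j then Function.update x i (f (x i)) else x := by
    intro f x
    simp only [ctl, Equiv.coe_fn_mk, Finset.mem_singleton, forall_eq, hji, ne_eq, not_false_eq_true,
      true_imp_iff]
  have e2 : ∀ (f : Perm A) (x : ι → A), ctl {l} w i f x =
      if x l = w l then Function.update x i (f (x i)) else x := by
    intro f x
    simp only [ctl, Equiv.coe_fn_mk, Finset.mem_singleton, forall_eq, hli, ne_eq, not_false_eq_true,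
      true_imp_iff]
  have e3 : ∀ (f : Perm A) (x : ι → A), ctl {j, l} w i f x =
      if x j = w j ∧ x l = w l then Function.update x i (f (x i)) else x := by
    intro f x
    simp only [ctl, Equiv.coe_fn_mk, Finset.mem_insert, Finset.mem_singleton, forall_eq_or_imp,
      forall_eq, hli, hji, ne_eq, not_false_eq_true, true_imp_iff]
  rw [e3, e1, e1, e2, e2]
  by_cases h1 : x j = w j <;> by_cases h2 : x l = w l <;>
    simp [h1, h2, hji, hli, Perm.mul_apply]

theorem swap_update_eq_ctl [Fintype ι] (u : ι → A) (i : ι) (b : A) :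
    swap u (Function.update u i b) = ctl Finset.univ u i (swap (u i) b) := by
  ext1 x
  by_cases h : ∀ j ∈ Finset.univ, j ≠ i → x j = u j
  · obtain ⟨c, rfl⟩ : ∃ c, x = Function.update u i c :=
      ⟨x i, by
        funext j
        by_cases hj : j = i
        · subst hj; simp
        · rw [Function.update_of_ne hj]; exact h j (Finset.mem_univ _) hj⟩
    rw [ctl_apply_of_pos _ h]
    simp only [Function.update_self, Function.update_idem]
    have hinj : Function.Injective (Function.update u i) := Function.update_injective u i
    have := hinj.map_swap (u i) b c
    rw [Function.update_eq_self] at this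
    exact this.symm
  · rw [ctl_apply_of_neg _ h, swap_apply_of_ne_of_ne]
    · rintro rfl; exact h fun _ _ _ => rfl
    · rintro rfl; exact h fun j _ hj => Function.update_of_ne hj _ _

end Ctl

section Generation

variable [DecidableEq A] [Finite A] {S : Set (Gate A)}

theorem ctl_perm_mem {n : ℕ} {s : Finset (Fin n)} {w : Fin n → A} {i : Fin n} {f : Perm A}
    (h : ctl s w i f ∈ genSubgroup S n) (σ : Perm (Fin n)) :
    ctl (s.image σ) (w ∘ σ.symm) (σ i) f ∈ genSubgroup S n := by
  have hP : (permGate A σ : Perm (Fin n → A)) ∈ genSubgroup S n := Generates.perm n σ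
  have key : ctl (s.image σ) (w ∘ σ.symm) (σ i) f =
      (permGate A σ : Perm (Fin n → A))⁻¹ * ctl s w i f * permGate A σ := by
    rw [mul_assoc, eq_inv_mul_iff_mul_eq]
    ext1 x
    rw [Perm.mul_apply, Perm.mul_apply]
    have hp : ∀ y : Fin n → A, (permGate A σ) y = fun j => y (σ j) := fun y => rfl
    rw [hp, hp]
    by_cases hx : ∀ j ∈ s, j ≠ i → x (σ j) = w j
    · rw [ctl_apply_of_pos f hx, ctl_apply_of_pos f (by simpa using hx)]
      funext j
      by_cases hj : j = i
      · subst hj; simp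
      · simp [hj]
    · rw [ctl_apply_of_neg f hx, ctl_apply_of_neg f (by simpa using hx)]
  rw [key]
  exact mul_mem (mul_mem (inv_mem hP) h) hP

theorem ctl_empty_mem (hS : ∀ a b : A, a ≠ b → (⟨1, tau ![a] ![b]⟩ : Gate A) ∈ S)
    {n : ℕ} (w : Fin n → A) (i : Fin n) (f : Perm A) : ctl ∅ w i f ∈ genSubgroup S n := by
  suffices h : (⊤ : Subgroup (Perm A)) ≤ (genSubgroup S n).comap (ctlHom ∅ w i) from
    h (Subgroup.mem_top f)
  rw [← Perm.closure_isSwap, Subgroup.closure_le]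
  rintro _ ⟨a, b, hab, rfl⟩
  show ctl ∅ w i (swap a b) ∈ genSubgroup S n
  obtain ⟨m, rfl⟩ : ∃ m, n = 1 + m := ⟨n - 1, by have := i.pos; omega⟩
  have h0 : ctl ∅ w (Fin.castAdd m 0) (swap a b) ∈ genSubgroup S (1 + m) := by
    have key : ctl ∅ w (Fin.castAdd m 0) (swap a b) =
        tensorGate (tau ![a] ![b]) (1 : Perm (Fin m → A)) := by
      ext x j
      rw [ctl_empty_apply]
      induction j using Fin.addCases with
      | left j =>
        rw [tensorGate_one_castAdd, Subsingleton.elim j 0, Function.update_self]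
        have hinj : Function.Injective (fun c : A => ![c]) := fun c d h => by simpa using h
        have hx : (fun j : Fin 1 => x (Fin.castAdd m j)) = ![x (Fin.castAdd m 0)] := by
          funext j
          rw [Subsingleton.elim j 0]
          rfl
        rw [hx]
        exact congrFun (hinj.map_swap a b (x (Fin.castAdd m 0))) 0
      | right j =>
        rw [tensorGate_one_natAdd, Function.update_of_ne]
        intro h
        have := congrArg Fin.val h
        simp at this
    rw [key]
    exact Generates.tensor (Generates.mem (hS a b hab)) (Generates.perm m 1)
  have := ctl_perm_mem h0 (swap (Fin.castAdd m 0) i)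
  rw [swap_apply_left, Finset.image_empty] at this
  rwa [ctl_congr _ (w' := w) (by simp)] at this

theorem ctl_singleton_mem (hS : ∀ a b : A, a ≠ b → (⟨1, tau ![a] ![b]⟩ : Gate A) ∈ S)
    {a b : A} (hab : a ≠ b) (hT : (⟨2, tau ![a, a] ![a, b]⟩ : Gate A) ∈ S)
    {n : ℕ} (w : Fin n → A) {i j : Fin n} (hji : j ≠ i) (f : Perm A) :
    ctl {j} w i f ∈ genSubgroup S n := by
  suffices h : ∀ w : Fin n → A, w j = a → ctl {j} w i (swap a b) ∈ genSubgroup S n by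
    suffices h : (⊤ : Subgroup (Perm A)) ≤ (genSubgroup S n).comap (ctlHom {j} w i) from
      h (Subgroup.mem_top f)
    rw [← Perm.closure_isSwap, Subgroup.closure_le]
    rintro _ ⟨c, d, hcd, rfl⟩
    show ctl {j} w i (swap c d) ∈ genSubgroup S n
    obtain ⟨g, hg⟩ := isConj_iff.1 (Perm.isConj_swap hab hcd)
    have h1 : ctl {j} w i (swap a b) ∈ genSubgroup S n := by
      have := ctl_conj_control (Function.update w j a) w hji (swap a b) (swap a (w j))
      simp only [Function.update_self, swap_apply_left, Function.update_idem,
        Function.update_eq_self] at this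
      rw [← this]
      exact mul_mem (mul_mem (ctl_empty_mem hS _ _ _) (h _ (by simp)))
        (inv_mem (ctl_empty_mem hS _ _ _))
    have h2 : ctl {j} w i (swap c d) =
        ctl ∅ w i g * ctl {j} w i (swap a b) * (ctl ∅ w i g)⁻¹ := by
      rw [← hg, eq_mul_inv_iff_mul_eq]
      ext1 x
      rw [Perm.mul_apply, Perm.mul_apply, ctl_empty_apply]
      by_cases hx : x j = w j
      · rw [ctl_apply_of_pos (s := {j}) (w := w) _ (by simpa [hji] using hx),
          ctl_apply_of_pos (s := {j}) (w := w) _ (by simpa [hji] using hx), ctl_empty_apply]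
        simp
      · rw [ctl_apply_of_neg (s := {j}) (w := w) _ (by simpa [hji] using hx),
          ctl_apply_of_neg (s := {j}) (w := w) _ (by simpa [hji] using hx), ctl_empty_apply]
    rw [h2]
    exact mul_mem (mul_mem (ctl_empty_mem hS _ _ _) h1) (inv_mem (ctl_empty_mem hS _ _ _))
  intro w hw
  obtain ⟨m, rfl⟩ : ∃ m, n = 2 + m := ⟨n - 2, by
    have := i.2; have := j.2; have := Fin.val_ne_of_ne hji; omega⟩
  have h01 : Fin.castAdd m (0 : Fin 2) ≠ Fin.castAdd m (1 : Fin 2) := fun h => by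
    have := congrArg Fin.val h
    simp at this
  have h0 : ctl {Fin.castAdd m (0 : Fin 2)} (fun _ => a) (Fin.castAdd m (1 : Fin 2)) (swap a b) ∈
      genSubgroup S (2 + m) := by
    have key : ctl {Fin.castAdd m (0 : Fin 2)} (fun _ => a) (Fin.castAdd m (1 : Fin 2))
        (swap a b) = tensorGate (tau ![a, a] ![a, b]) (1 : Perm (Fin m → A)) := by
      have htau : ∀ y : Fin 2 → A,
          tau ![a, a] ![a, b] y = if y 0 = a then ![y 0, swap a b (y 1)] else y := by
        intro y
        obtain ⟨c, d, rfl⟩ : ∃ c d, y = ![c, d] := ⟨y 0, y 1, by ext j; fin_cases j <;> rfl⟩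
        by_cases hc : c = a
        · subst hc
          have hinj : Function.Injective (fun d : A => ![c, d]) := fun d e h => by simpa using h
          simpa [tau] using (hinj.map_swap c b d).symm
        · simp only [tau, Matrix.cons_val_zero, hc, if_false]
          exact swap_apply_of_ne_of_ne (fun h => hc (congrFun h 0)) fun h => hc (congrFun h 0)
      ext x l
      induction l using Fin.addCases with
      | left l =>
        rw [tensorGate_one_castAdd, htau]
        by_cases hx : x (Fin.castAdd m 0) = a
        · rw [ctl_apply_of_pos _ (by simpa [h01] using hx), if_pos hx]
          fin_cases l
          · exact Function.update_of_ne h01 _ _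
          · exact Function.update_self ..
        · rw [ctl_apply_of_neg _ (by simpa [h01] using hx), if_neg hx]
      | right l =>
        rw [tensorGate_one_natAdd, ctl_apply_of_ne]
        intro h
        have := congrArg Fin.val h
        simp at this
        omega
    rw [key]
    exact Generates.tensor (Generates.mem hT) (Generates.perm m 1)
  set z := Fin.castAdd m (0 : Fin 2)
  set o := Fin.castAdd m (1 : Fin 2)
  have hz : swap (swap z j o) i j = j := by
    refine swap_apply_of_ne_of_ne ?_ hji
    intro h
    apply h01
    apply (swap z j).injective
    rw [swap_apply_left]
    exact h
  have := ctl_perm_mem h0 (swap (swap z j o) i * swap z j)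
  rw [Finset.image_singleton, Perm.mul_apply, Perm.mul_apply, swap_apply_left, swap_apply_left,
    hz] at this
  rwa [ctl_congr _ (w' := w) (by simpa using fun _ => hw.symm)] at this

/-- Store the outcome of the controls in `s` on a fresh wire, then use that wire as a control. -/
theorem ctl_union_mem {n : ℕ} {s t : Finset (Fin n)} {w : Fin n → A} {i : Fin n} {f c : Perm A}
    {a : A} (hi : i ∉ s) (hc : c a ≠ a)
    (hK : ctl (s.image (Fin.natAdd 1)) ((splitEquiv A 1 n).symm (fun _ => c a, w))
      (Fin.castAdd n 0) c ∈ genSubgroup S (1 + n))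
    (hL : ctl (insert (Fin.castAdd n 0) (t.image (Fin.natAdd 1)))
      ((splitEquiv A 1 n).symm (fun _ => c a, w)) (Fin.natAdd 1 i) f ∈ genSubgroup S (1 + n)) :
    ctl (s ∪ t) w i f ∈ genSubgroup S n := by
  refine Generates.ancilla (fun _ : Fin 1 => a) (mul_mem (mul_mem (inv_mem hK) hL) hK) ?_
  intro x
  rw [Perm.mul_apply, Perm.mul_apply, Perm.inv_eq_iff_eq]
  have hne : ∀ j : Fin n, Fin.natAdd 1 j ≠ Fin.castAdd n (0 : Fin 1) := fun j h => by
    have := congrArg Fin.val h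
    simp at this
  have hupd0 : ∀ (p : Fin 1 → A) (y : Fin n → A) (d : A),
      Function.update ((splitEquiv A 1 n).symm (p, y)) (Fin.castAdd n 0) d =
        (splitEquiv A 1 n).symm (fun _ => d, y) := by
    intro p y d
    funext l
    induction l using Fin.addCases with
    | left l => rw [Subsingleton.elim l 0, splitEquiv_symm_castAdd, Function.update_self]
    | right l => rw [Function.update_of_ne (hne l), splitEquiv_symm_natAdd, splitEquiv_symm_natAdd]
  have hupd1 : ∀ (p : Fin 1 → A) (y : Fin n → A) (d : A),
      Function.update ((splitEquiv A 1 n).symm (p, y)) (Fin.natAdd 1 i) d =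
        (splitEquiv A 1 n).symm (p, Function.update y i d) := by
    intro p y d
    funext l
    induction l using Fin.addCases with
    | left l =>
      rw [Subsingleton.elim l 0, Function.update_of_ne (hne i).symm, splitEquiv_symm_castAdd,
        splitEquiv_symm_castAdd]
    | right l =>
      rw [splitEquiv_symm_natAdd]
      by_cases hl : l = i
      · subst hl; simp
      · rw [Function.update_of_ne hl, Function.update_of_ne, splitEquiv_symm_natAdd]
        simpa using hl
  have eK : ∀ (p : Fin 1 → A) (y : Fin n → A),
      ctl (s.image (Fin.natAdd 1)) ((splitEquiv A 1 n).symm (fun _ => c a, w))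
        (Fin.castAdd n 0) c ((splitEquiv A 1 n).symm (p, y)) =
      (splitEquiv A 1 n).symm (if ∀ j ∈ s, y j = w j then fun _ => c (p 0) else p, y) := by
    intro p y
    by_cases hy : ∀ j ∈ s, y j = w j
    · rw [if_pos hy, ctl_apply_of_pos, hupd0, splitEquiv_symm_castAdd]
      simpa [splitEquiv_symm_natAdd, hne] using hy
    · rw [if_neg hy, ctl_apply_of_neg]
      simpa [splitEquiv_symm_natAdd, hne] using hy
  have eL : ∀ (p : Fin 1 → A) (y : Fin n → A),
      ctl (insert (Fin.castAdd n 0) (t.image (Fin.natAdd 1)))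
        ((splitEquiv A 1 n).symm (fun _ => c a, w)) (Fin.natAdd 1 i) f
        ((splitEquiv A 1 n).symm (p, y)) =
      (splitEquiv A 1 n).symm
        (p, if p 0 = c a ∧ ∀ j ∈ t, j ≠ i → y j = w j then Function.update y i (f (y i)) else y) := by
    intro p y
    have hiff : (∀ j ∈ insert (Fin.castAdd n 0) (t.image (Fin.natAdd 1)), j ≠ Fin.natAdd 1 i →
        (splitEquiv A 1 n).symm (p, y) j = (splitEquiv A 1 n).symm (fun _ => c a, w) j) ↔
        p 0 = c a ∧ ∀ j ∈ t, j ≠ i → y j = w j := by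
      rw [Finset.forall_mem_insert, Finset.forall_mem_image]
      simp only [splitEquiv_symm_castAdd, splitEquiv_symm_natAdd, ne_eq, (hne i).symm,
        not_false_eq_true, true_imp_iff, Fin.natAdd_inj]
    by_cases hy : p 0 = c a ∧ ∀ j ∈ t, j ≠ i → y j = w j
    · rw [if_pos hy, ctl_apply_of_pos _ (hiff.2 hy), hupd1, splitEquiv_symm_natAdd]
    · rw [if_neg hy, ctl_apply_of_neg _ (mt hiff.1 hy)]
  rw [eK, eL, eK]
  have hiff : (∀ j ∈ s ∪ t, j ≠ i → x j = w j) ↔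
      (∀ j ∈ s, x j = w j) ∧ ∀ j ∈ t, j ≠ i → x j = w j := by
    rw [Finset.forall_mem_union]
    refine and_congr_left' (forall_congr' fun j => forall_congr' fun hj => ?_)
    simp [ne_of_mem_of_not_mem hj hi]
  have hs : (∀ j ∈ s, ctl (s ∪ t) w i f x j = w j) ↔ ∀ j ∈ s, x j = w j :=
    forall_congr' fun j => forall_congr' fun hj => by
      rw [ctl_apply_of_ne _ _ _ _ _ (ne_of_mem_of_not_mem hj hi)]
  simp only [hs]
  by_cases h1 : ∀ j ∈ s, x j = w j
  · by_cases h2 : ∀ j ∈ t, j ≠ i → x j = w j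
    · rw [ctl_apply_of_pos _ (hiff.2 ⟨h1, h2⟩)]
      simp only [if_pos h1, if_pos h2, true_and]
    · rw [ctl_apply_of_neg _ fun h => h2 (hiff.1 h).2]
      simp only [if_pos h1, if_neg h2, true_and]
  · rw [ctl_apply_of_neg _ fun h => h1 (hiff.1 h).1]
    simp only [if_neg h1, hc.symm, false_and, if_false]

theorem ctl_pair_mem (hS : ∀ a b : A, a ≠ b → (⟨1, tau ![a] ![b]⟩ : Gate A) ∈ S)
    {a b c : A} (hab : a ≠ b) (hac : a ≠ c) (hbc : b ≠ c)
    (hT : (⟨2, tau ![a, a] ![a, b]⟩ : Gate A) ∈ S)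
    {n : ℕ} (w : Fin n → A) {i j l : Fin n} (hji : j ≠ i) (hli : l ≠ i) (f : Perm A) :
    ctl {j, l} w i f ∈ genSubgroup S n := by
  have hsing {m : ℕ} (w : Fin m → A) {i j : Fin m} (hji : j ≠ i) (f : Perm A) :
      ctl {j} w i f ∈ genSubgroup S m := ctl_singleton_mem hS hab hT w hji f
  have hne : ∀ j : Fin n, Fin.natAdd 1 j ≠ Fin.castAdd n (0 : Fin 1) := fun j h => by
    have := congrArg Fin.val h
    simp at this
  rw [← Finset.union_empty {j, l}]
  refine ctl_union_mem (a := a)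
    (c := swap a b * swap b c * (swap a b)⁻¹ * (swap b c)⁻¹) ?_ ?_ ?_ ?_
  · simp [hji.symm, hli.symm]
  · simp [Perm.mul_apply, swap_apply_of_ne_of_ne hab hac, swap_apply_of_ne_of_ne hac.symm hbc.symm,
      hac.symm]
  · rw [Finset.image_insert, Finset.image_singleton, ctl_commutator _ (hne j) (hne l)]
    exact mul_mem (mul_mem (mul_mem (hsing _ (hne j) _) (hsing _ (hne l) _))
      (inv_mem (hsing _ (hne j) _))) (inv_mem (hsing _ (hne l) _))
  · rw [Finset.image_empty]
    exact hsing _ (hne i).symm _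

theorem ctl_mem (hS : ∀ a b : A, a ≠ b → (⟨1, tau ![a] ![b]⟩ : Gate A) ∈ S)
    {a b c : A} (hab : a ≠ b) (hac : a ≠ c) (hbc : b ≠ c)
    (hT : (⟨2, tau ![a, a] ![a, b]⟩ : Gate A) ∈ S)
    {n : ℕ} (s : Finset (Fin n)) (w : Fin n → A) {i : Fin n} (hi : i ∉ s) (f : Perm A) :
    ctl s w i f ∈ genSubgroup S n := by
  induction hcard : s.card generalizing n f with
  | zero =>
    rw [Finset.card_eq_zero.1 hcard]
    exact ctl_empty_mem hS w i f
  | succ m ih =>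
    obtain ⟨j, t, hjt, rfl, ht⟩ := Finset.card_eq_succ.1 hcard
    have hne : ∀ j : Fin n, Fin.natAdd 1 j ≠ Fin.castAdd n (0 : Fin 1) := fun j h => by
      have := congrArg Fin.val h
      simp at this
    rw [Finset.mem_insert, not_or] at hi
    rw [Finset.insert_eq, Finset.union_comm]
    refine ctl_union_mem (a := a) (c := swap a b) hi.2 (by simpa using hab.symm) ?_ ?_
    · refine ih _ _ ?_ _ ?_
      · simp [hne]
      · rw [Finset.card_image_of_injective _ (Fin.natAdd_injective n 1), ht]
    · rw [Finset.image_singleton]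
      exact ctl_pair_mem hS hab hac hbc hT _ (hne i).symm (by simpa using Ne.symm hi.1) _

theorem genSubgroup_eq_top (hS : ∀ a b : A, a ≠ b → (⟨1, tau ![a] ![b]⟩ : Gate A) ∈ S)
    {a b c : A} (hab : a ≠ b) (hac : a ≠ c) (hbc : b ≠ c)
    (hT : (⟨2, tau ![a, a] ![a, b]⟩ : Gate A) ∈ S) (n : ℕ) : genSubgroup S n = ⊤ := by
  have hstep : ∀ (u : Fin n → A) (i : Fin n) (d : A),
      swap u (Function.update u i d) ∈ genSubgroup S n := by
    intro u i d
    rw [swap_update_eq_ctl]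
    have : ctl Finset.univ u i (swap (u i) d) = ctl (Finset.univ.erase i) u i (swap (u i) d) := by
      ext1 x
      simp only [ctl, Equiv.coe_fn_mk]
      congr 1
      simp
    rw [this]
    exact ctl_mem hS hab hac hbc hT _ _ (Finset.notMem_erase i _) _
  rw [eq_top_iff, ← Perm.closure_isSwap, Subgroup.closure_le]
  rintro _ ⟨x, y, -, rfl⟩
  have h : ∀ s : Finset (Fin n), swap x (s.piecewise y x) ∈ genSubgroup S n := by
    intro s
    induction s using Finset.induction_on with
    | empty =>
      rw [Finset.piecewise_empty, swap_self]
      exact one_mem _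
    | insert j s _ ih =>
      rw [Finset.piecewise_insert]
      exact SubmonoidClass.swap_mem_trans _ ih (hstep _ _ _)
  simpa using h Finset.univ

end Generation

end ReversibleGate

/-- Over `A = {1,…,k}` with `k ≥ 3`, the set `S` consisting of `τ_{a,b}` for all
`a ≠ b ∈ A` together with `τ_{11,12}` generates the class `ALL` of all reversible
gates (here the symbols `1,2` are `⟨0,_⟩, ⟨1,_⟩ : Fin k`). -/
theorem closure_eq_all (k : ℕ) (hk : 3 ≤ k) :
    genClosure ({g : Gate (Fin k) | ∃ a b : Fin k, a ≠ b ∧ g = ⟨1, tau ![a] ![b]⟩} ∪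
      {(⟨2, tau ![(⟨0, by omega⟩ : Fin k), ⟨0, by omega⟩]
          ![(⟨0, by omega⟩ : Fin k), ⟨1, by omega⟩]⟩ : Gate (Fin k))}) = (Set.univ : Set (Gate (Fin k))) := by
  rw [Set.eq_univ_iff_forall]
  rintro ⟨n, F⟩
  have h := ReversibleGate.genSubgroup_eq_top (A := Fin k) (S := {g : Gate (Fin k) | ∃ a b : Fin k, a ≠ b ∧ g = ⟨1, tau ![a] ![b]⟩} ∪
      {(⟨2, tau ![(⟨0, by omega⟩ : Fin k), ⟨0, by omega⟩]
          ![(⟨0, by omega⟩ : Fin k), ⟨1, by omega⟩]⟩ : Gate (Fin k))})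
    (fun a b hab => Set.mem_union_left _ ⟨a, b, hab, rfl⟩)
    (a := ⟨0, by omega⟩) (b := ⟨1, by omega⟩) (c := ⟨2, by omega⟩)
    (by simp) (by simp) (by simp) (Set.mem_union_right _ rfl) n
  exact (Subgroup.eq_top_iff' _).1 h F
end

section
/- Let A = {1,…,k} with k ≥ 3, and let S be the set of gates consisting of τ_{a,b} for all a ≠ b ∈ A together with τ_{11,12}. Then S generates τ_{abc,abd} for all a, b, c, d ∈ A. -/
namespace Generates

variable {A : Type*} {S : Set (Gate A)}

/-- The gate applying the permutation `p` of the alphabet to its single input. -/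
def unaryGate (p : Equiv.Perm A) : GateFun A 1 := Equiv.arrowCongr (Equiv.refl _) p

theorem refl (n : ℕ) : Generates S ⟨n, Equiv.refl _⟩ := perm n 1

theorem conj {n : ℕ} {F P : GateFun A n} (hF : Generates S ⟨n, F⟩) (hP : Generates S ⟨n, P⟩)
    (hP' : Generates S ⟨n, P.symm⟩) : Generates S ⟨n, (P.symm.trans F).trans P⟩ :=
  hP.comp (hF.comp hP')

theorem tensorGate_unaryGate_apply (p q : Equiv.Perm A) (a b : A) :
    tensorGate (unaryGate p) (unaryGate q) ![a, b] = ![p a, q b] := by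
  ext i
  fin_cases i <;> rfl

variable [DecidableEq A]

theorem unaryGate_swap (a b : A) : unaryGate (Equiv.swap a b) = tau ![a] ![b] := by
  ext x i
  obtain rfl := Subsingleton.elim i 0
  have h (c : A) : x = ![c] ↔ x 0 = c := by
    simp [funext_iff]
  simp only [unaryGate, tau, Equiv.arrowCongr_apply, Equiv.swap_apply_def, h]
  simp only [Function.comp_apply, Equiv.refl_symm, Equiv.refl_apply, Equiv.swap_apply_def]
  split_ifs <;> simp

theorem unary [Finite A] (hS : ∀ a b : A, a ≠ b → Generates S ⟨1, tau ![a] ![b]⟩)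
    (p : Equiv.Perm A) : Generates S ⟨1, unaryGate p⟩ := by
  induction p using Equiv.Perm.swap_induction_on with
  | one => exact refl 1
  | swap_mul p a b hab ih =>
    exact Generates.comp (F := unaryGate (Equiv.swap a b)) (unaryGate_swap a b ▸ hS a b hab) ih

theorem exists_perm_apply_eq {u v c d : A} (huv : u ≠ v) (hcd : c ≠ d) :
    ∃ p : Equiv.Perm A, p u = c ∧ p v = d := by
  refine ⟨(Equiv.swap u c).trans (Equiv.swap (Equiv.swap u c v) d), ?_, by simp⟩
  have : c ≠ Equiv.swap u c v := by
    intro h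
    exact huv ((Equiv.swap u c).injective (by rw [← h, Equiv.swap_apply_left]))
  simp [Equiv.swap_apply_of_ne_of_ne this hcd]

theorem tau_pair [Finite A] (hS : ∀ a b : A, a ≠ b → Generates S ⟨1, tau ![a] ![b]⟩)
    {u v : A} (huv : u ≠ v) (h : Generates S ⟨2, tau ![u, u] ![u, v]⟩) (a c d : A) :
    Generates S ⟨2, tau ![a, c] ![a, d]⟩ := by
  by_cases hcd : c = d
  · subst hcd
    rw [tau, Equiv.swap_self]
    exact refl 2
  obtain ⟨q, rfl, rfl⟩ := exists_perm_apply_eq huv hcd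
  have hconj := conj h (tensor (unary hS (Equiv.swap u a)) (unary hS q))
    (tensor (unary hS (Equiv.swap u a).symm) (unary hS q.symm))
  convert hconj using 2
  rw [tau, tau, Equiv.symm_trans_swap_trans]
  simp only [tensorGate_unaryGate_apply, Equiv.swap_apply_left]

/-- The gate exchanging `c` and `d` on wire `j` whenever wire `i` carries `a`. -/
def controlledSwap {n : ℕ} {i j : Fin n} (hij : i ≠ j) (a c d : A) : GateFun A n :=
  Function.Involutive.toPerm
    (fun x => if x i = a then Function.update x j (Equiv.swap c d (x j)) else x) fun x => by
      by_cases h : x i = a <;> simp [h, hij]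

theorem controlledSwap_apply {n : ℕ} {i j : Fin n} (hij : i ≠ j) (a c d : A) (x : Fin n → A) :
    controlledSwap hij a c d x =
      if x i = a then Function.update x j (Equiv.swap c d (x j)) else x := rfl

theorem controlledSwap_generates {n : ℕ} {a c d : A}
    (h : Generates S ⟨2, tau ![a, c] ![a, d]⟩) {i j : Fin (2 + n)} (hij : i ≠ j) :
    Generates S ⟨2 + n, controlledSwap hij a c d⟩ := by
  have h01 : Fin.castAdd n (0 : Fin 2) ≠ Fin.castAdd n 1 := by simp [Fin.ext_iff]
  obtain ⟨σ, rfl, rfl⟩ := exists_perm_apply_eq h01 hij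
  have hconj := conj (h.tensor (refl n)) (perm (2 + n) σ.symm) (perm (2 + n) σ)
  convert hconj using 2
  ext x w
  obtain ⟨w, rfl⟩ := σ.surjective w
  have hl (y : Fin (2 + n) → A) (s : Fin 2) :
      tensorGate (tau ![a, c] ![a, d]) (Equiv.refl (Fin n → A)) y (Fin.castAdd n s) =
        tau ![a, c] ![a, d] (fun s => y (Fin.castAdd n s)) s := by
    simp [tensorGate, splitEquiv, Equiv.sumArrowEquivProdArrow]
    rfl
  have hr (y : Fin (2 + n) → A) (s : Fin n) :
      tensorGate (tau ![a, c] ![a, d]) (Equiv.refl (Fin n → A)) y (Fin.natAdd 2 s) =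
        y (Fin.natAdd 2 s) := by
    simp [tensorGate, splitEquiv, Equiv.sumArrowEquivProdArrow]
  have hp (y : Fin (2 + n) → A) : permGate A σ.symm y (σ w) = y w := by
    simp [permGate]
  have hσ (s : Fin (2 + n)) : permGate A σ x s = x (σ s) := by
    simp [permGate]
  have hsymm : (permGate A σ.symm).symm = permGate A σ := rfl
  rw [Equiv.trans_apply, hp, Equiv.trans_apply, hsymm]
  have hv (e : A) : (fun s : Fin 2 => x (σ (Fin.castAdd n s))) = ![a, e] ↔
      x (σ (Fin.castAdd n 0)) = a ∧ x (σ (Fin.castAdd n 1)) = e := by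
    simp [funext_iff, Fin.forall_fin_two]
  induction w using Fin.addCases with
  | left s =>
    rw [hl, controlledSwap_apply]
    simp only [hσ, tau, Equiv.swap_apply_def, hv]
    fin_cases s <;> by_cases h0 : x (σ (Fin.castAdd n 0)) = a <;>
      simp [h0] <;> split_ifs <;> simp_all
  | right s =>
    rw [hr, hσ, controlledSwap_apply]
    have : Fin.natAdd 2 s ≠ Fin.castAdd n 1 := by simp [Fin.ext_iff]; omega
    split_ifs <;> simp [this]

theorem tau_triple {u v w : A} (huv : u ≠ v) (huw : u ≠ w) (hvw : v ≠ w)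
    (h : ∀ a c d : A, Generates S ⟨2, tau ![a, c] ![a, d]⟩) (a b c d : A) :
    Generates S ⟨3, tau ![a, b, c] ![a, b, d]⟩ := by
  have h10 : (1 : Fin (2 + 2)) ≠ 0 := by decide
  have h20 : (2 : Fin (2 + 2)) ≠ 0 := by decide
  have h03 : (0 : Fin (2 + 2)) ≠ 3 := by decide
  have hP := controlledSwap_generates (h a u v) h10
  have hQ := controlledSwap_generates (h b v w) h20
  have hT := controlledSwap_generates (h w c d) h03
  have hC := (hP.comp hQ).comp (hP.comp hQ)
  have hC' := (hQ.comp hP).comp (hQ.comp hP)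
  refine ancilla (l := 1) (m := 3) ![u] (hC'.comp (hT.comp hC)) fun x => ?_
  have hs (y : Fin 3 → A) : (splitEquiv A 1 3).symm (![u], y) = ![u, y 0, y 1, y 2] := by
    ext i
    fin_cases i <;> rfl
  have hx (e : A) : x = ![a, b, e] ↔ x 0 = a ∧ x 1 = b ∧ x 2 = e := by
    simp [funext_iff, Fin.forall_fin_succ]
  rw [hs, hs]
  simp only [Equiv.trans_apply, controlledSwap_apply, tau, Equiv.swap_apply_def, hx]
  have hupd (p q r s t : A) : Function.update ![p, q, r, s] (0 : Fin 4) t = ![t, q, r, s] := by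
    ext i
    fin_cases i <;> rfl
  have hupd' (p q r s t : A) : Function.update ![p, q, r, s] (3 : Fin 4) t = ![p, q, r, t] := by
    ext i
    fin_cases i <;> rfl
  by_cases h0 : x 0 = a <;> by_cases h1 : x 1 = b <;> by_cases h2 : x 2 = c <;>
    by_cases h3 : x 2 = d <;>
    simp [h0, h1, h2, h3, hupd, hupd', huv, huw, huv.symm, huw.symm, hvw.symm]
  split_ifs <;> simp

end Generates

/-- Over `A = {1,…,k}` with `k ≥ 3`, the set `S` consisting of `τ_{a,b}` for all
`a ≠ b ∈ A` together with `τ_{11,12}` generates `τ_{abc,abd}` for all `a,b,c,d ∈ A`. -/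
theorem generates_tau_abc_abd (k : ℕ) (hk : 3 ≤ k) (a b c d : Fin k) :
    Generates ({g : Gate (Fin k) | ∃ a b : Fin k, a ≠ b ∧ g = ⟨1, tau ![a] ![b]⟩} ∪
      {(⟨2, tau ![(⟨0, by omega⟩ : Fin k), ⟨0, by omega⟩]
          ![(⟨0, by omega⟩ : Fin k), ⟨1, by omega⟩]⟩ : Gate (Fin k))})
      ⟨3, tau ![a, b, c] ![a, b, d]⟩ := by
  have hne {m n : ℕ} (hm : m < k) (hn : n < k) (h : m ≠ n) : (⟨m, hm⟩ : Fin k) ≠ ⟨n, hn⟩ := by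
    simpa using h
  refine Generates.tau_triple (u := ⟨0, by omega⟩) (v := ⟨1, by omega⟩) (w := ⟨2, by omega⟩)
    (hne _ _ (by decide)) (hne _ _ (by decide)) (hne _ _ (by decide)) ?_ a b c d
  exact Generates.tau_pair (fun a b hab => .mem (.inl ⟨a, b, hab, rfl⟩))
    (hne _ _ (by decide)) (.mem (.inr rfl))
end

section
/- Let A = {1,…,k} with k ≥ 3, and let S be the set of gates consisting of τ_{a,b} for all a ≠ b ∈ A together with τ_{11,12}. Then S generates the controlled transposition w-τ_{a,b} for every string w over A and all a, b ∈ A. -/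
theorem splitEquiv_symm_eq_append {A : Type*} {n m : ℕ} (u : Fin n → A) (v : Fin m → A) :
    (splitEquiv A n m).symm (u, v) = Fin.append u v := by
  ext i
  refine Fin.addCases (fun i => ?_) (fun i => ?_) i <;>
    simp [splitEquiv, Equiv.sumArrowEquivProdArrow, Equiv.arrowCongr]

theorem splitEquiv_apply {A : Type*} {n m : ℕ} (x : Fin (n + m) → A) :
    splitEquiv A n m x = (x ∘ Fin.castAdd m, x ∘ Fin.natAdd n) := by
  ext i <;> simp [splitEquiv, Equiv.sumArrowEquivProdArrow, Equiv.arrowCongr]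

theorem tensorGate_apply {A : Type*} {n m : ℕ} (F : GateFun A n) (G : GateFun A m)
    (x : Fin (n + m) → A) :
    tensorGate F G x =
      Fin.append (F (x ∘ Fin.castAdd m)) (G (x ∘ Fin.natAdd n)) := by
  simp [tensorGate, splitEquiv_symm_eq_append, splitEquiv_apply]

theorem permGate_apply {A : Type*} {n : ℕ} (σ : Equiv.Perm (Fin n)) (x : Fin n → A) :
    permGate A σ x = x ∘ σ := by
  ext i
  simp [permGate, Equiv.arrowCongr]

theorem tau_single_apply {A : Type*} [DecidableEq A] (a b : A) (x : Fin 1 → A) :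
    tau ![a] ![b] x = fun i => Equiv.swap a b (x i) := by
  have h (c : A) : x = ![c] ↔ x 0 = c :=
    ⟨fun h => by simp [h], fun h => by ext i; fin_cases i; simpa using h⟩
  ext i
  obtain rfl : i = 0 := Subsingleton.elim _ _
  simp only [tau, Equiv.swap_apply_def, h]
  split_ifs <;> simp

theorem controlled_tau_apply {A : Type*} [DecidableEq A] {l : ℕ} (w : Fin l → A) (a b : A)
    (x : Fin (l + 1) → A) :
    controlled w (tau ![a] ![b]) x =
      if ∀ i : Fin l, x i.castSucc = w i then
        Function.update x (Fin.last l) (Equiv.swap a b (x (Fin.last l))) else x := by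
  have h : (x ∘ Fin.castAdd 1 = w) ↔ ∀ i : Fin l, x i.castSucc = w i := funext_iff
  simp only [controlled, Equiv.trans_apply, splitEquiv_apply, Equiv.prodCongrRight_apply,
    splitEquiv_symm_eq_append, h]
  split_ifs with hx
  · ext i
    refine Fin.addCases (fun i => ?_) (fun i => ?_) i
    · rw [Fin.append_left]
      exact (Function.update_of_ne (Fin.castSucc_lt_last i).ne _ x).symm
    · fin_cases i
      rw [tau_single_apply, Fin.append_right]
      exact (Function.update_self (Fin.last l) _ x).symm
  · ext i
    refine Fin.addCases (fun i => ?_) (fun i => ?_) i <;> simp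

namespace Generates

variable {A : Type*} {S : Set (Gate A)}

/-- A generated gate can be applied to any choice of distinct wires. -/
theorem exists_on_wires {m n : ℕ} {F : GateFun A m} (hF : Generates S ⟨m, F⟩)
    (f : Fin m ↪ Fin n) :
    ∃ G : GateFun A n, Generates S ⟨n, G⟩ ∧
      ∀ x, (∀ i, G x (f i) = F (x ∘ f) i) ∧ ∀ j, j ∉ Set.range f → G x j = x j := by
  obtain ⟨r, rfl⟩ := Nat.exists_eq_add_of_le (by simpa using Fintype.card_le_of_embedding f)
  obtain ⟨σ, hσ⟩ : ∃ σ : Equiv.Perm (Fin (m + r)), ∀ i, σ (Fin.castAdd r i) = f i := by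
    let e := (Equiv.ofInjective _ (Fin.castAdd_injective m r)).symm.trans
      (Equiv.ofInjective f f.injective)
    refine ⟨e.extendSubtype, fun i => ?_⟩
    rw [Equiv.extendSubtype_apply_of_mem e _ ⟨i, rfl⟩]
    have h : (Equiv.ofInjective _ (Fin.castAdd_injective m r)).symm ⟨Fin.castAdd r i, ⟨i, rfl⟩⟩ = i :=
      Equiv.ofInjective_symm_apply (Fin.castAdd_injective m r) i
    simp only [e, Equiv.trans_apply, h, Equiv.ofInjective_apply]
  refine ⟨_, comp (perm _ σ.symm) (comp (hF.tensor (refl r)) (perm _ σ)), fun x => ⟨fun i => ?_,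
    fun j hj => ?_⟩⟩
  · have hx : (x ∘ σ) ∘ Fin.castAdd r = x ∘ f := by
      ext i
      simp [hσ]
    simp [permGate_apply, tensorGate_apply, ← hσ, hx]
  · obtain ⟨j, rfl⟩ := σ.surjective j
    revert hj
    refine Fin.addCases (fun i hj => ?_) (fun i _ => ?_) j
    · exact (hj ⟨i, (hσ i).symm⟩).elim
    · simp [permGate_apply, tensorGate_apply]

/-- Applying a controlled transposition to chosen control wires `c` and target wire `t`. -/
theorem exists_controlled_on_wires [DecidableEq A] {l n : ℕ} {w : Fin l → A} {a b : A}
    (h : Generates S ⟨l + 1, controlled w (tau ![a] ![b])⟩)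
    (c : Fin l → Fin n) (hc : Function.Injective c) (t : Fin n) (ht : ∀ i, c i ≠ t) :
    ∃ G : GateFun A n, Generates S ⟨n, G⟩ ∧ ∀ x, G x =
      if ∀ i, x (c i) = w i then Function.update x t (Equiv.swap a b (x t)) else x := by
  let f : Fin (l + 1) ↪ Fin n := ⟨Fin.snoc c t, Fin.snoc_injective_of_injective hc (by
    rintro ⟨i, hi⟩
    exact ht i hi)⟩
  have hf_castSucc (i : Fin l) : f i.castSucc = c i := Fin.snoc_castSucc (α := fun _ => Fin n) t c i
  have hf_last : f (Fin.last l) = t := Fin.snoc_last (α := fun _ => Fin n) t c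
  obtain ⟨G, hG, hG'⟩ := h.exists_on_wires f
  refine ⟨G, hG, fun x => ?_⟩
  ext j
  by_cases hj : j ∈ Set.range f
  · obtain ⟨i, rfl⟩ := hj
    rw [(hG' x).1, controlled_tau_apply]
    simp only [Function.comp_apply, hf_castSucc, hf_last]
    split_ifs
    · refine Fin.lastCases ?_ (fun i => ?_) i
      · simp [hf_last]
      · simp [hf_castSucc, ht, (Fin.castSucc_lt_last i).ne]
    · rfl
  · have hjt : j ≠ t := fun h => hj ⟨Fin.last l, hf_last.trans h.symm⟩
    rw [(hG' x).2 j hj]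
    split_ifs <;> simp [hjt]

/-- One more control can be added to a controlled transposition, by means of an ancilla. -/
theorem controlled_tau_succ [DecidableEq A] {l : ℕ} {w : Fin (l + 1) → A} {p q r a b : A}
    (hpq : p ≠ q) (hpr : p ≠ r) (hqr : q ≠ r)
    (hU : Generates S ⟨l + 1, controlled (w ∘ Fin.castSucc) (tau ![p] ![q])⟩)
    (hV : Generates S ⟨1 + 1, controlled ![w (Fin.last l)] (tau ![q] ![r])⟩)
    (hW : Generates S ⟨1 + 1, controlled ![r] (tau ![a] ![b])⟩) :
    Generates S ⟨l + 1 + 1, controlled w (tau ![a] ![b])⟩ := by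
  let z : Fin (1 + (l + 1 + 1)) := Fin.castAdd _ 0
  let d : Fin (l + 1 + 1) → Fin (1 + (l + 1 + 1)) := Fin.natAdd 1
  have hd : Function.Injective d := Fin.natAdd_injective _ _
  have hdz (i) : d i ≠ z := Fin.ne_of_val_ne (by
    simp only [d, z, Fin.val_natAdd, Fin.val_castAdd, Fin.val_zero]
    omega)
  obtain ⟨U, hU, hU'⟩ := hU.exists_controlled_on_wires
    (fun i => d i.castSucc.castSucc)
    (hd.comp ((Fin.castSucc_injective _).comp (Fin.castSucc_injective _))) z (fun i => hdz _)
  obtain ⟨V, hV, hV'⟩ := hV.exists_controlled_on_wires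
    (fun _ => d (Fin.last l).castSucc) (Function.injective_of_subsingleton _) z (fun i => hdz _)
  obtain ⟨W, hW, hW'⟩ := hW.exists_controlled_on_wires
    (fun _ => z) (Function.injective_of_subsingleton _) (d (Fin.last _)) (fun i => (hdz _).symm)
  have hC := (hU.comp hV).comp hU
  refine ancilla (l := 1) ![p] ((hC.comp hW).comp hC) fun y => ?_
  simp only [splitEquiv_symm_eq_append, controlled_tau_apply, Equiv.trans_apply]
  set x := Fin.append ![p] y with hx
  have hxz : x z = p := by simp [hx, z]
  have hxd (i) : x (d i) = y i := by simp [hx, d]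
  have hupd (v) : Fin.append ![p] (Function.update y (Fin.last _) v) =
      Function.update x (d (Fin.last _)) v := by
    ext i
    refine Fin.addCases (fun i => ?_) (fun i => ?_) i
    · have h : Fin.castAdd (l + 1 + 1) i ≠ d (Fin.last _) := by
        simp [d, Fin.ext_iff]
      simp [hx, h]
    · by_cases h : i = Fin.last _
      · subst h
        rw [Fin.append_right]
        simp only [d, Function.update_self]
      · have h' : Fin.natAdd 1 i ≠ d (Fin.last _) := fun h' => h (hd h')
        simp [hx, h, h']
  have hne (i : Fin (l + 1)) : d i.castSucc ≠ d (Fin.last _) :=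
    fun h => (Fin.castSucc_lt_last i).ne (hd h)
  have hcond : (∀ i : Fin (l + 1), y i.castSucc = w i) ↔
      (∀ i : Fin l, y i.castSucc.castSucc = w i.castSucc) ∧
        y (Fin.last l).castSucc = w (Fin.last l) := Fin.forall_fin_succ'
  simp only [apply_ite (Fin.append ![p]), hupd, ← hx, hcond]
  by_cases hP : ∀ i : Fin l, y i.castSucc.castSucc = w i.castSucc <;>
  by_cases hQ : y (Fin.last l).castSucc = w (Fin.last l) <;>
  simp [hU', hV', hW', hdz, hxz, hxd, hP, hQ, hpq, hpr, hpr.symm, hqr.symm,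
    (hdz _).symm, hne, Function.update_comm (hdz (Fin.last _)).symm, Equiv.swap_apply_of_ne_of_ne,
    Function.update_eq_self_iff]

theorem single_wire [DecidableEq A] [Finite A]
    (h : ∀ a b : A, a ≠ b → Generates S ⟨1, tau ![a] ![b]⟩) (π : Equiv.Perm A) :
    Generates S ⟨1, (Equiv.refl (Fin 1)).arrowCongr π⟩ := by
  induction π using Equiv.Perm.swap_induction_on with
  | one => exact refl 1
  | swap_mul π a b hab ih =>
    convert (h a b hab).comp ih using 2
    ext x i
    simp [tau_single_apply, Equiv.arrowCongr]

theorem controlled_tau_one [DecidableEq A] [Finite A]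
    (h : ∀ a b : A, a ≠ b → Generates S ⟨1, tau ![a] ![b]⟩) {p q r : A} (hqr : q ≠ r)
    (h2 : Generates S ⟨2, tau ![p, q] ![p, r]⟩) (c a b : A) (hab : a ≠ b) :
    Generates S ⟨1 + 1, controlled ![c] (tau ![a] ![b])⟩ := by
  obtain ⟨ρ, hρa, hρb⟩ : ∃ ρ : Equiv.Perm A, ρ q = a ∧ ρ r = b := by
    refine ⟨(Equiv.swap q a).trans (Equiv.swap (Equiv.swap q a r) b), ?_, by simp⟩
    rw [Equiv.trans_apply, Equiv.swap_apply_left]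
    refine Equiv.swap_apply_of_ne_of_ne (fun h => hqr ?_) hab
    exact (Equiv.swap q a).injective ((Equiv.swap_apply_left q a).trans h)
  let P (π : Equiv.Perm A) : GateFun A 1 := (Equiv.refl (Fin 1)).arrowCongr π
  let f : GateFun A 2 := tensorGate (P (Equiv.swap p c)) (P ρ)
  have hf : Generates S ⟨2, f⟩ := (single_wire h _).tensor (single_wire h _)
  have hf' : Generates S ⟨2, f⁻¹⟩ :=
    (single_wire h (Equiv.swap p c).symm).tensor (single_wire h ρ.symm)
  have hfp (s : A) : f ![p, s] = ![c, ρ s] := by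
    ext i
    fin_cases i
    · exact Equiv.swap_apply_left p c
    · rfl
  have key : controlled ![c] (tau ![a] ![b]) = f * Equiv.swap ![p, q] ![p, r] * f⁻¹ := by
    rw [← Equiv.swap_apply_apply, hfp, hfp, hρa, hρb]
    ext x : 1
    have hx (s : A) : x = ![c, s] ↔ x 0 = c ∧ x 1 = s := by
      simp [funext_iff]
    rw [controlled_tau_apply]
    simp only [Equiv.swap_apply_def (_ : Fin 2 → A), hx]
    have hlast : Fin.last 1 = 1 := rfl
    simp only [Fin.forall_fin_one, Fin.castSucc_zero, hlast, Equiv.swap_apply_def,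
      Matrix.cons_val_zero]
    by_cases h0 : x 0 = c
    · simp only [h0, true_and, if_true]
      split_ifs <;> ext i <;> fin_cases i <;> simp [h0]
    · simp [h0]
  rw [key]
  exact hf.comp (h2.comp hf')

end Generates

/-- Over `A = {1,…,k}` with `k ≥ 3`, the set `S` consisting of `τ_{a,b}` for all
`a ≠ b ∈ A` together with `τ_{11,12}` generates the controlled transposition
`w-τ_{a,b}` for every string `w` over `A` and all `a, b ∈ A`. -/
theorem generates_controlled_tau (k : ℕ) (hk : 3 ≤ k)
    (l : ℕ) (w : Fin l → Fin k) (a b : Fin k) :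
    Generates ({g : Gate (Fin k) | ∃ a b : Fin k, a ≠ b ∧ g = ⟨1, tau ![a] ![b]⟩} ∪
      {(⟨2, tau ![(⟨0, by omega⟩ : Fin k), ⟨0, by omega⟩]
          ![(⟨0, by omega⟩ : Fin k), ⟨1, by omega⟩]⟩ : Gate (Fin k))})
      ⟨l + 1, controlled w (tau ![a] ![b])⟩ := by
  set S : Set (Gate (Fin k)) := _ ∪ _
  have hrefl (n : ℕ) (w : Fin n → Fin k) (a : Fin k) :
      Generates S ⟨n + 1, controlled w (tau ![a] ![a])⟩ := by
    convert Generates.refl (n + 1)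
    ext x i
    simp [controlled_tau_apply]
  have h1 (a b : Fin k) (hab : a ≠ b) : Generates S ⟨1, tau ![a] ![b]⟩ :=
    .mem (.inl ⟨a, b, hab, rfl⟩)
  have h2 (c a b : Fin k) : Generates S ⟨1 + 1, controlled ![c] (tau ![a] ![b])⟩ := by
    obtain rfl | hab := eq_or_ne a b
    · exact hrefl _ _ _
    · exact Generates.controlled_tau_one h1 (by simp) (.mem (.inr rfl)) c a b hab
  induction l generalizing a b with
  | zero =>
    obtain rfl | hab := eq_or_ne a b
    · exact hrefl _ _ _
    · convert h1 a b hab using 2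
      ext x i
      fin_cases i
      simp [controlled_tau_apply, tau_single_apply]
  | succ l ih =>
    exact Generates.controlled_tau_succ (p := ⟨0, by omega⟩) (q := ⟨1, by omega⟩)
      (r := ⟨2, by omega⟩)
      (Fin.ne_of_val_ne (by simp)) (Fin.ne_of_val_ne (by simp)) (Fin.ne_of_val_ne (by simp))
      (ih _ _ _) (h2 _ _ _) (h2 _ _ _)
end
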